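/- arXiv:2005.04042 — 2 statements merged into one kernel-verified Lean document; each statement's English description precedes it below -/
import Mathlib

section
/- Let Σ = {a_1, …, a_k} and for i ∈ {1, …, n} and j ∈ {1, …, k} let U_j^{(i)} ⊆ {a_j}* be nonempty unary languages, each of which is either infinite or a singleton; set L = ⋃_{i=1}^n U_1^{(i)} ⧢ ⋯ ⧢ U_k^{(i)}. Suppose there are distinct i_0, i_1 ∈ {1, …, n} such that for every j ∈ {1, …, k}: if U_j^{(i_0)} is infinite then U_j^{(i_1)} is infinite, and if U_j^{(i_0)} = {u} is a singleton then U_j^{(i_1)} is infinite or U_j^{(i_1)} = {v} is a singleton with |u| ≤ |v| (i.e., the vector associated with component i_0 is componentwise at most that of component i_1). Let L' = ⋃_{i ∈ {1,…,n} \ {i_0}} U_1^{(i)} ⧢ ⋯ ⧢ U_k^{(i)}. Then every deterministic complete semi-automaton A = (Σ, Q, δ) has a synchronizing word in L if and only if it has a synchronizing word in L'. -/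
/-- `Interleave u v w` holds iff `w` is obtained by interleaving (shuffling)
the words `u` and `v`, keeping the relative order of letters of each. -/
inductive Interleave {α : Type*} : List α → List α → List α → Prop
  | nil : Interleave [] [] []
  | left {a : α} {u v w : List α} : Interleave u v w → Interleave (a :: u) v (a :: w)
  | right {a : α} {u v w : List α} : Interleave u v w → Interleave u (a :: v) (a :: w)

/-- The shuffle of two languages. -/
def shuf {α : Type*} (L₁ L₂ : Set (List α)) : Set (List α) :=
  {w | ∃ u ∈ L₁, ∃ v ∈ L₂, Interleave u v w}

/-- The shuffle `U 0 ⧢ U 1 ⧢ ⋯ ⧢ U (k-1)` of a family of `k` languages. -/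
def shufFam {α : Type*} {k : ℕ} (U : Fin k → Set (List α)) : Set (List α) :=
  (List.finRange k).foldr (fun j acc => shuf (U j) acc) {[]}

/-- A word `w` is synchronizing for the complete deterministic semi-automaton
with transition function `δ` if all states are mapped to one common state. -/
def IsSyncWord {Q α : Type*} (δ : Q → α → Q) (w : List α) : Prop :=
  ∃ q : Q, ∀ p : Q, w.foldl δ p = q

theorem Interleave.count_eq {α : Type*} [DecidableEq α] {u v w : List α}
    (h : Interleave u v w) (a : α) : w.count a = u.count a + v.count a := by
  induction h with
  | nil => simp
  | left _ ih => simp only [List.count_cons, ih]; omega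
  | right _ ih => simp only [List.count_cons, ih]; omega

theorem interleave_filter {α : Type*} (p : α → Bool) (w : List α) :
    Interleave (w.filter p) (w.filter fun a => !p a) w := by
  induction w with
  | nil => exact .nil
  | cons a w ih =>
    cases h : p a
    · simpa [h] using ih.right
    · simpa [h] using ih.left

/-- A shuffle of unary languages over distinct letters is determined by letter counts. -/
theorem mem_foldr_shuf_iff {α : Type*} [DecidableEq α] (U : α → Set (List α))
    (hU : ∀ j, U j ⊆ {w | ∃ m : ℕ, w = List.replicate m j}) (l : List α) (hl : l.Nodup)
    (w : List α) :
    w ∈ l.foldr (fun j acc => shuf (U j) acc) {[]} ↔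
      (∀ j ∈ l, List.replicate (w.count j) j ∈ U j) ∧ ∀ a ∈ w, a ∈ l := by
  induction l generalizing w with
  | nil => simp [List.eq_nil_iff_forall_not_mem]
  | cons j l ih =>
    obtain ⟨hj, hl⟩ := List.nodup_cons.mp hl
    rw [List.foldr_cons]
    constructor
    · rintro ⟨u, hu, v, hv, h⟩
      obtain ⟨hv, hvl⟩ := (ih hl v).mp hv
      obtain ⟨m, rfl⟩ := hU j hu
      have hc := h.count_eq
      have hvj : v.count j = 0 := List.count_eq_zero.mpr fun hm => hj (hvl j hm)
      refine ⟨fun i hi => ?_, fun a ha => ?_⟩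
      · rcases List.mem_cons.mp hi with rfl | hi
        · rw [hc, hvj, List.count_replicate_self]
          exact hu
        · have hne : j ≠ i := fun e => hj (e ▸ hi)
          rw [hc, List.count_replicate, if_neg (by simpa using hne), zero_add]
          exact hv i hi
      · by_contra hn
        simp only [List.mem_cons, not_or] at hn
        have h0 := hc a
        rw [List.count_replicate, if_neg (by simpa using Ne.symm hn.1),
          List.count_eq_zero.mpr fun hm => hn.2 (hvl a hm)] at h0
        exact List.count_eq_zero.mp h0 ha
    · rintro ⟨hc, hw⟩
      refine ⟨_, ?_, _, ?_, interleave_filter (fun a => a == j) w⟩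
      · rw [List.filter_beq]
        exact hc j List.mem_cons_self
      · refine (ih hl _).mpr ⟨fun i hi => ?_, fun a ha => ?_⟩
        · have hne : i ≠ j := fun e => hj (e ▸ hi)
          rw [List.count_filter (by simpa using hne)]
          exact hc i (List.mem_cons_of_mem _ hi)
        · rw [List.mem_filter] at ha
          exact (List.mem_cons.mp (hw a ha.1)).resolve_left (by simpa using ha.2)

theorem mem_shufFam_iff {k : ℕ} (U : Fin k → Set (List (Fin k)))
    (hU : ∀ j, U j ⊆ {w | ∃ m : ℕ, w = List.replicate m j}) (w : List (Fin k)) :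
    w ∈ shufFam U ↔ ∀ j, List.replicate (w.count j) j ∈ U j := by
  rw [shufFam, mem_foldr_shuf_iff U hU _ (List.nodup_finRange k)]
  simp

theorem exists_le_replicate_mem {α : Type*} {j : α} {S : Set (List α)}
    (hS : S ⊆ {w | ∃ m : ℕ, w = List.replicate m j}) (hinf : S.Infinite) (N : ℕ) :
    ∃ m, N ≤ m ∧ List.replicate m j ∈ S := by
  by_contra! h
  refine hinf (((Set.finite_Iio N).image fun m => List.replicate m j).subset fun w hw => ?_)
  obtain ⟨m, rfl⟩ := hS hw
  exact ⟨m, not_le.mp fun hm => h m hm hw, rfl⟩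

theorem exists_list_count_eq {α : Type*} [Finite α] [DecidableEq α] (f : α → ℕ) :
    ∃ w : List α, ∀ a, w.count a = f a := by
  refine ⟨(Finsupp.equivFunOnFinite.symm f).toMultiset.toList, fun a => ?_⟩
  rw [← Multiset.coe_count, Multiset.coe_toList, Finsupp.count_toMultiset]
  rfl

theorem IsSyncWord.append {Q α : Type*} {δ : Q → α → Q} {w : List α} (h : IsSyncWord δ w)
    (e : List α) : IsSyncWord δ (w ++ e) := by
  obtain ⟨q, hq⟩ := h
  exact ⟨e.foldl δ q, fun p => by rw [List.foldl_append, hq]⟩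

/-- The alphabet `Σ = {a_1, …, a_k}` is modeled as `Fin k`.  The languages
`U i j ⊆ {a_j}*` are nonempty and each infinite or a singleton.  If the vector
associated with component `i0` is componentwise at most that of component `i1`
(for `i0 ≠ i1`), then dropping component `i0` from the union does not change
the existence of a synchronizing word in the constraint language, for every
deterministic complete semi-automaton. -/
theorem stmt4 {k n : ℕ} (U : Fin n → Fin k → Set (List (Fin k)))
    (hU : ∀ i j, U i j ⊆ {w | ∃ m : ℕ, w = List.replicate m j})
    (hne : ∀ i j, (U i j).Nonempty)
    (hform : ∀ i j, (U i j).Infinite ∨ ∃ u, U i j = {u})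
    (i0 i1 : Fin n) (hdist : i0 ≠ i1)
    (hle : ∀ j, ((U i0 j).Infinite → (U i1 j).Infinite) ∧
      (∀ u, U i0 j = {u} →
        (U i1 j).Infinite ∨ ∃ v, U i1 j = {v} ∧ u.length ≤ v.length))
    (Q : Type*) [Finite Q] [Nonempty Q] (δ : Q → Fin k → Q) :
    (∃ w ∈ ⋃ i, shufFam (U i), IsSyncWord δ w) ↔
    (∃ w ∈ ⋃ i, ⋃ (_ : i ≠ i0), shufFam (U i), IsSyncWord δ w) := by
  simp only [Set.mem_iUnion]
  constructor
  · rintro ⟨w, ⟨i, hw⟩, hs⟩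
    by_cases hi : i = i0
    · subst hi
      rw [mem_shufFam_iff _ (hU i)] at hw
      have key : ∀ j, ∃ m, w.count j ≤ m ∧ List.replicate m j ∈ U i1 j := by
        intro j
        by_cases hinf : (U i1 j).Infinite
        · exact exists_le_replicate_mem (hU i1 j) hinf _
        · obtain ⟨u, hu⟩ := (hform i j).resolve_left fun h => hinf ((hle j).1 h)
          obtain ⟨v, hv, huv⟩ := ((hle j).2 u hu).resolve_left hinf
          obtain ⟨m, hm⟩ := hU i1 j (hv ▸ rfl : v ∈ U i1 j)
          have hwu := hw j
          rw [hu, Set.mem_singleton_iff] at hwu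
          refine ⟨m, ?_, ?_⟩
          · simpa [← hwu, hm] using huv
          · rw [← hm, hv]
            rfl
      choose m hm hmem using key
      obtain ⟨e, he⟩ := exists_list_count_eq fun j => m j - w.count j
      refine ⟨w ++ e, ⟨i1, hdist.symm, (mem_shufFam_iff _ (hU i1) _).mpr fun j => ?_⟩,
        hs.append e⟩
      rw [List.count_append, he, Nat.add_sub_cancel' (hm j)]
      exact hmem j
    · exact ⟨w, ⟨i, hi, hw⟩, hs⟩
  · rintro ⟨w, ⟨i, _, hw⟩, hs⟩
    exact ⟨w, ⟨i, hw⟩, hs⟩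
end

section
/- Let Σ = {a_1, …, a_k} and let L ⊆ Σ* be a commutative language. Then L is regular if and only if L can be written in the form L = ⋃_{i=1}^n U_1^{(i)} ⧢ ⋯ ⧢ U_k^{(i)}, where each U_j^{(i)} ⊆ {a_j}* (for i ∈ {1, …, n}, j ∈ {1, …, k}) is a nonempty unary language that is either a singleton {a_j^c} for some c ≥ 0, or of the form {a_j^{c+np} | n ∈ ℕ} for some c ≥ 0 and p ≥ 1 (these are precisely the nonempty unary languages accepted by a unary automaton with a single final state). -/
theorem Interleave.perm {α : Type*} {u v w : List α} (h : Interleave u v w) :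
    w.Perm (u ++ v) := by
  induction h with
  | nil => simp
  | left _ ih => exact ih.cons _
  | right _ ih => exact (ih.cons _).trans List.perm_middle.symm

/-- The unary language over the letter `j` whose set of word lengths is `S`. -/
def unaryLang {α : Type*} (j : α) (S : Set ℕ) : Set (List α) :=
  {w | ∃ m ∈ S, w = List.replicate m j}

theorem mem_foldr_shuf_unaryLang {α : Type*} [DecidableEq α] (S : α → Set ℕ) (l : List α)
    (hl : l.Nodup) (w : List α) :
    w ∈ l.foldr (fun j acc => shuf (unaryLang j (S j)) acc) {[]} ↔
      (∀ j ∈ l, w.count j ∈ S j) ∧ ∀ a ∈ w, a ∈ l := by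
  induction l generalizing w with
  | nil => simp [List.eq_nil_iff_forall_not_mem]
  | cons j l ih =>
    obtain ⟨hj, hl⟩ := List.nodup_cons.1 hl
    rw [List.foldr_cons]
    constructor
    · rintro ⟨u, ⟨m, hm, rfl⟩, v, hv, h⟩
      obtain ⟨hv₁, hv₂⟩ := (ih hl v).1 hv
      have hcount i := h.perm.count_eq i
      simp only [List.count_append, List.count_replicate] at hcount
      refine ⟨fun i hi => ?_, fun a ha => ?_⟩
      · rw [hcount]
        rcases List.mem_cons.1 hi with rfl | hi
        · simpa [List.count_eq_zero_of_not_mem fun h => hj (hv₂ _ h)] using hm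
        · have hne : j ≠ i := fun h => hj (h ▸ hi)
          simpa [hne] using hv₁ i hi
      · rcases List.mem_append.1 (h.perm.mem_iff.1 ha) with ha | ha
        · simp [List.eq_of_mem_replicate ha]
        · exact List.mem_cons_of_mem _ (hv₂ a ha)
    · rintro ⟨h₁, h₂⟩
      refine ⟨_, ⟨w.count j, h₁ j (by simp), List.filter_beq j⟩, _, (ih hl _).2 ⟨?_, ?_⟩,
        interleave_filter (· == j) w⟩
      · intro i hi
        have hne : i ≠ j := fun h => hj (h ▸ hi)
        rw [List.count_filter (by simpa using hne)]
        exact h₁ i (List.mem_cons_of_mem _ hi)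
      · intro a ha
        obtain ⟨ha, hne⟩ := List.mem_filter.1 ha
        exact (List.mem_cons.1 (h₂ a ha)).resolve_left (by simpa using hne)

theorem mem_shufFam_unaryLang {k : ℕ} (S : Fin k → Set ℕ) (w : List (Fin k)) :
    w ∈ shufFam (fun j => unaryLang j (S j)) ↔ ∀ j, w.count j ∈ S j := by
  simp [shufFam, mem_foldr_shuf_unaryLang S _ (List.nodup_finRange k)]

theorem finite_range_shift {S : Set ℕ} {N p : ℕ} (hp : 1 ≤ p)
    (h : ∀ n ≥ N, n + p ∈ S ↔ n ∈ S) : (Set.range fun n => {m | n + m ∈ S}).Finite := by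
  refine ((Set.finite_lt_nat (N + p)).image fun n => {m | n + m ∈ S}).subset ?_
  rintro _ ⟨n, rfl⟩
  induction n using Nat.strong_induction_on with
  | _ n ih =>
    by_cases hn : n < N + p
    · exact ⟨n, hn, rfl⟩
    · convert ih (n - p) (by omega) using 1
      ext m
      have := h (n - p + m) (by omega)
      rwa [show n - p + m + p = n + m by omega] at this

theorem isRegular_iUnion_count {α ι : Type*} [Finite α] [DecidableEq α] [Finite ι]
    (S : ι → α → Set ℕ) (hS : ∀ i j, (Set.range fun n => {m | n + m ∈ S i j}).Finite) :
    Language.IsRegular {w : List α | ∃ i, ∀ j, w.count j ∈ S i j} := by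
  refine Language.IsRegular.of_finite_range_leftQuotient ?_
  refine ((Set.Finite.pi' fun i => Set.Finite.pi' (hS i)).image
    fun T => {y : List α | ∃ i, ∀ j, y.count j ∈ T i j}).subset ?_
  rintro _ ⟨x, rfl⟩
  refine ⟨fun i j => {m | x.count j + m ∈ S i j}, fun i j => ⟨_, rfl⟩, ?_⟩
  ext y
  change _ ↔ ∃ i, ∀ j, (x ++ y).count j ∈ S i j
  simp only [List.count_append]
  rfl

/-- The block containing `n` of the partition of `ℕ` into the singletons below `N` and the
residue classes modulo `p` from `N` on. -/
def block (N p n : ℕ) : Set ℕ :=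
  if n < N then {n} else {l | ∃ m, l = N + (n - N) % p + m * p}

theorem self_mem_block (N p n : ℕ) : n ∈ block N p n := by
  unfold block
  split_ifs with h
  · rfl
  · refine ⟨(n - N) / p, ?_⟩
    have := Nat.mod_add_div' (n - N) p
    omega

theorem finite_range_block (N : ℕ) {p : ℕ} (hp : 1 ≤ p) : (Set.range (block N p)).Finite := by
  refine ((Set.finite_lt_nat (N + p)).image (block N p)).subset ?_
  rintro _ ⟨n, rfl⟩
  by_cases h : n < N
  · exact ⟨n, by simp only [Set.mem_ofPred_eq]; omega, rfl⟩
  · refine ⟨N + (n - N) % p, ?_, by simp [block, h]⟩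
    have := Nat.mod_lt (n - N) hp
    simp only [Set.mem_ofPred_eq]
    omega

theorem iterate_eq_of_mem_block {Q : Type*} {f : Q → Q} {N p m n : ℕ}
    (hf : f^[N + p] = f^[N]) (h : m ∈ block N p n) : f^[m] = f^[n] := by
  have key (r l : ℕ) : f^[N + r + l * p] = f^[N + r] := by
    induction l with
    | zero => simp
    | succ l ih =>
      rw [show N + r + (l + 1) * p = (r + l * p) + (N + p) by ring, Function.iterate_add, hf,
        ← Function.iterate_add, ← ih]
      congr 1
      ring
  have aux {a : ℕ} (hn : ¬ n < N) (ha : a ∈ block N p n) : f^[a] = f^[N + (n - N) % p] := by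
    rw [block, if_neg hn] at ha
    obtain ⟨l, rfl⟩ := ha
    exact key _ l
  by_cases hn : n < N
  · rw [block, if_pos hn] at h
    rw [Set.mem_singleton_iff.1 h]
  · rw [aux hn h, aux hn (self_mem_block N p n)]

theorem exists_iterate_add_eq {Q : Type*} [Finite Q] (f : Q → Q) :
    ∃ N p, 1 ≤ p ∧ f^[N + p] = f^[N] := by
  obtain ⟨m, n, hne, h⟩ := Finite.exists_ne_map_eq_of_infinite fun n => f^[n]
  wlog hlt : m < n generalizing m n
  · exact this n m hne.symm h.symm (by omega)
  · exact ⟨m, n - m, by omega, by rw [Nat.add_sub_cancel' hlt.le]; exact h.symm⟩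

theorem DFA.evalFrom_replicate {α Q : Type*} (M : DFA α Q) (q : Q) (n : ℕ) (a : α) :
    M.evalFrom q (List.replicate n a) = (fun q => M.step q a)^[n] q := by
  induction n generalizing q with
  | zero => rfl
  | succ n ih => rw [List.replicate_succ, DFA.evalFrom_cons, ih, Function.iterate_succ_apply]

theorem DFA.evalFrom_flatMap_replicate_congr {α Q : Type*} (M : DFA α Q) {c d : α → ℕ}
    (h : ∀ a, (fun q => M.step q a)^[c a] = (fun q => M.step q a)^[d a]) (l : List α) (q : Q) :
    M.evalFrom q (l.flatMap fun a => List.replicate (c a) a) =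
      M.evalFrom q (l.flatMap fun a => List.replicate (d a) a) := by
  induction l generalizing q with
  | nil => rfl
  | cons a l ih =>
    simp only [List.flatMap_cons, DFA.evalFrom_of_append, DFA.evalFrom_replicate, h a, ih]

theorem perm_flatMap_replicate_count {k : ℕ} (w : List (Fin k)) :
    w.Perm ((List.finRange k).flatMap fun j => List.replicate (w.count j) j) := by
  rw [List.perm_iff_count]
  intro i
  rw [List.count_flatMap,
    ← Fin.sum_univ_def (List.count i ∘ fun j => List.replicate (w.count j) j)]
  simp [List.count_replicate]

theorem mem_of_count_mem_block {k : ℕ} {L : Set (List (Fin k))}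
    (hcomm : ∀ u v : List (Fin k), u.Perm v → (u ∈ L ↔ v ∈ L)) {Q : Type*} (M : DFA (Fin k) Q)
    (hM : ∀ w, w ∈ M.accepts ↔ w ∈ L) {N p : Fin k → ℕ}
    (hf : ∀ j, (fun q => M.step q j)^[N j + p j] = (fun q => M.step q j)^[N j])
    {v w : List (Fin k)} (hv : v ∈ L) (h : ∀ j, w.count j ∈ block (N j) (p j) (v.count j)) :
    w ∈ L := by
  rw [hcomm _ _ (perm_flatMap_replicate_count _), ← hM, DFA.mem_accepts] at hv ⊢
  unfold DFA.eval at hv ⊢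
  rwa [M.evalFrom_flatMap_replicate_congr fun j => iterate_eq_of_mem_block (hf j) (h j)]

/-- The alphabet `Σ = {a_1, …, a_k}` is modeled as `Fin k`.  A commutative
language `L ⊆ Σ*` is regular (accepted by some DFA with finitely many states)
iff it is a finite union of shuffles `U_1^{(i)} ⧢ ⋯ ⧢ U_k^{(i)}` of nonempty
unary languages, where each `U_j^{(i)} ⊆ {a_j}*` is either a singleton
`{a_j^c}` or of the form `{a_j^{c+mp} | m ∈ ℕ}` with `p ≥ 1` — precisely the
nonempty unary languages accepted by a unary automaton with a single final
state. -/
theorem stmt12 {k : ℕ} (L : Set (List (Fin k)))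
    (hcomm : ∀ u v : List (Fin k), u.Perm v → (u ∈ L ↔ v ∈ L)) :
    (∃ (Q : Type) (_ : Fintype Q) (M : DFA (Fin k) Q), ∀ w, w ∈ M.accepts ↔ w ∈ L) ↔
    (∃ (n : ℕ) (U : Fin n → Fin k → Set (List (Fin k))),
      (∀ i j, (∃ c : ℕ, U i j = {List.replicate c j}) ∨
        (∃ c p : ℕ, 1 ≤ p ∧
          U i j = {w | ∃ m : ℕ, w = List.replicate (c + m * p) j})) ∧
      L = ⋃ i, shufFam (U i)) := by
  constructor
  · rintro ⟨Q, _, M, hM⟩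
    choose N p hp hf using fun j => exists_iterate_add_eq fun q => M.step q j
    let F (w : List (Fin k)) (j : Fin k) : Set ℕ := block (N j) (p j) (w.count j)
    have hfin : (F '' L).Finite := by
      refine (Set.Finite.pi' fun j => finite_range_block (N j) (hp j)).subset ?_
      rintro _ ⟨w, -, rfl⟩ j
      exact ⟨_, rfl⟩
    obtain ⟨n, S, -, hS⟩ := hfin.fin_param
    refine ⟨n, fun i j => unaryLang j (S i j), fun i j => ?_, ?_⟩
    · obtain ⟨w, -, hw⟩ : S i ∈ F '' L := hS ▸ ⟨i, rfl⟩
      simp only [← hw, F, block]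
      split_ifs
      · exact .inl ⟨w.count j, by ext; simp [unaryLang]⟩
      · refine .inr ⟨N j + (w.count j - N j) % p j, p j, hp j, ?_⟩
        ext
        simp [unaryLang]
    · ext w
      simp only [Set.mem_iUnion, mem_shufFam_unaryLang]
      constructor
      · intro hw
        obtain ⟨i, hi⟩ : F w ∈ Set.range S := hS ▸ ⟨w, hw, rfl⟩
        exact ⟨i, fun j => hi ▸ self_mem_block _ _ _⟩
      · rintro ⟨i, hi⟩
        obtain ⟨v, hv, hvi⟩ : S i ∈ F '' L := hS ▸ ⟨i, rfl⟩
        rw [← hvi] at hi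
        exact mem_of_count_mem_block hcomm M hM hf hv hi
  · rintro ⟨n, U, hU, rfl⟩
    have hS (i : Fin n) (j : Fin k) : ∃ S : Set ℕ, U i j = unaryLang j S ∧
        (Set.range fun n => {m | n + m ∈ S}).Finite := by
      rcases hU i j with ⟨c, hc⟩ | ⟨c, p, hp, hc⟩
      · refine ⟨{c}, by rw [hc]; ext; simp [unaryLang],
          finite_range_shift (N := c + 1) le_rfl fun n hn => ?_⟩
        simp only [Set.mem_singleton_iff]
        omega
      · refine ⟨{l | ∃ m, l = c + m * p}, by rw [hc]; ext; simp [unaryLang],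
          finite_range_shift (N := c) hp fun n hn => ⟨?_, ?_⟩⟩
        · rintro ⟨_ | m, hm⟩
          · omega
          · exact ⟨m, by rw [Nat.succ_mul] at hm; omega⟩
        · rintro ⟨m, rfl⟩
          exact ⟨m + 1, by ring⟩
    choose S hS hfin using hS
    obtain ⟨Q, hQ, M, hM⟩ := isRegular_iUnion_count S hfin
    refine ⟨Q, hQ, M, fun w => ?_⟩
    have hU' (i : Fin n) : U i = fun j => unaryLang j (S i j) := funext (hS i)
    simp only [hM, hU', Set.mem_iUnion, mem_shufFam_unaryLang]
    rfl
end
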